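/- For a fixed real number k > -1 and coprime positive integers m, n, the improper integral ∫₁^∞ (π_k(t; m, n) − π(t^{k+1}; m, n)) / t^{k+2} dt converges and equals −log(k+1) / ((k+1) φ(m)). -/

import Mathlib

open Real Filter Finset

/-- The finset of primes `p ≤ x` with `p ≡ n (mod m)`. -/
noncomputable def primesTo (x : ℝ) (m n : ℕ) : Finset ℕ :=
  (Finset.range (⌊x⌋₊ + 1)).filter fun p => p.Prime ∧ p % m = n % m

/-- `π(x; m, n)`, the number of primes `p ≤ x` with `p ≡ n (mod m)`. -/
noncomputable def piCount (x : ℝ) (m n : ℕ) : ℝ := (primesTo x m n).card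

/-- `π_k(x; m, n) = Σ_{p ≤ x, p ≡ n (mod m)} p^k`. -/
noncomputable def piPow (k x : ℝ) (m n : ℕ) : ℝ :=
  ∑ p ∈ primesTo x m n, (p : ℝ) ^ k

open MeasureTheory Topology

/-- The weighted average `δ ∑ A(n) n^{-δ} g(n^{-δ})`. -/
noncomputable def karamataMean (A : ℕ → ℝ) (g : ℝ → ℝ) (δ : ℝ) : ℝ :=
  δ * ∑' n : ℕ, A n * (n : ℝ) ^ (-δ) * g ((n : ℝ) ^ (-δ))

/-- Nonnegative coefficients whose Dirichlet series has a simple pole of residue `C` at `0`. -/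
structure HasDirichletResidue (A : ℕ → ℝ) (C : ℝ) : Prop where
  nonneg : ∀ n, 0 ≤ A n
  zero : A 0 = 0
  residue_nonneg : 0 ≤ C
  summable : ∀ δ : ℝ, 0 < δ → Summable fun n : ℕ => A n * (n : ℝ) ^ (-δ)
  tendsto : Tendsto (fun δ : ℝ => δ * ∑' n : ℕ, A n * (n : ℝ) ^ (-δ)) (𝓝[>] 0) (𝓝 C)

/-- `g` is a bounded integrable function on `[0, 1]` whose weighted averages converge to
`C` times its integral. -/
structure KaramataAveraging (A : ℕ → ℝ) (C : ℝ) (g : ℝ → ℝ) : Prop where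
  bounded : ∃ M, ∀ t ∈ Set.Icc (0 : ℝ) 1, |g t| ≤ M
  integrable : IntervalIntegrable g volume 0 1
  tendsto : Tendsto (karamataMean A g) (𝓝[>] 0) (𝓝 (C * ∫ t in (0 : ℝ)..1, g t))

lemma natCast_rpow_neg_mem_Icc {n : ℕ} (hn : n ≠ 0) {δ : ℝ} (hδ : 0 < δ) :
    (n : ℝ) ^ (-δ) ∈ Set.Icc (0 : ℝ) 1 :=
  ⟨by positivity, Real.rpow_le_one_of_one_le_of_nonpos
    (by exact_mod_cast Nat.one_le_iff_ne_zero.mpr hn) (by linarith)⟩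

namespace HasDirichletResidue

variable {A : ℕ → ℝ} {C : ℝ}

lemma summable_mul (h : HasDirichletResidue A C) {g : ℝ → ℝ}
    (hg : ∃ M, ∀ t ∈ Set.Icc (0 : ℝ) 1, |g t| ≤ M) {δ : ℝ} (hδ : 0 < δ) :
    Summable fun n : ℕ => A n * (n : ℝ) ^ (-δ) * g ((n : ℝ) ^ (-δ)) := by
  obtain ⟨M, hM⟩ := hg
  refine Summable.of_norm_bounded ((h.summable δ hδ).mul_right M) fun n => ?_
  have hw : 0 ≤ A n * (n : ℝ) ^ (-δ) := mul_nonneg (h.nonneg n) (by positivity)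
  rw [norm_mul, Real.norm_of_nonneg hw, Real.norm_eq_abs]
  rcases eq_or_ne n 0 with rfl | hn
  · simp [h.zero]
  · exact mul_le_mul_of_nonneg_left (hM _ (natCast_rpow_neg_mem_Icc hn hδ)) hw

lemma karamataMean_add (h : HasDirichletResidue A C) {f g : ℝ → ℝ}
    (hf : ∃ M, ∀ t ∈ Set.Icc (0 : ℝ) 1, |f t| ≤ M)
    (hg : ∃ M, ∀ t ∈ Set.Icc (0 : ℝ) 1, |g t| ≤ M) {δ : ℝ} (hδ : 0 < δ) :
    karamataMean A (fun t => f t + g t) δ = karamataMean A f δ + karamataMean A g δ := by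
  simp only [karamataMean, mul_add (A _ * _)]
  rw [(h.summable_mul hf hδ).tsum_add (h.summable_mul hg hδ), mul_add]

lemma karamataMean_const_mul (r : ℝ) (g : ℝ → ℝ) (δ : ℝ) :
    karamataMean A (fun t => r * g t) δ = r * karamataMean A g δ := by
  simp only [karamataMean, mul_left_comm _ r, tsum_mul_left]

lemma abs_karamataMean_sub_le (h : HasDirichletResidue A C) {f g e : ℝ → ℝ}
    (hf : ∃ M, ∀ t ∈ Set.Icc (0 : ℝ) 1, |f t| ≤ M)
    (hg : ∃ M, ∀ t ∈ Set.Icc (0 : ℝ) 1, |g t| ≤ M)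
    (he : ∃ M, ∀ t ∈ Set.Icc (0 : ℝ) 1, |e t| ≤ M)
    (hle : ∀ t ∈ Set.Icc (0 : ℝ) 1, |g t - f t| ≤ e t) {δ : ℝ} (hδ : 0 < δ) :
    |karamataMean A g δ - karamataMean A f δ| ≤ karamataMean A e δ := by
  have sf := h.summable_mul hf hδ
  have sg := h.summable_mul hg hδ
  have se := h.summable_mul he hδ
  rw [karamataMean, karamataMean, karamataMean, ← mul_sub, ← sg.tsum_sub sf, abs_mul,
    abs_of_pos hδ]
  refine mul_le_mul_of_nonneg_left ?_ hδ.le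
  rw [← Real.norm_eq_abs]
  refine tsum_of_norm_bounded se.hasSum fun n => ?_
  have hw : 0 ≤ A n * (n : ℝ) ^ (-δ) := mul_nonneg (h.nonneg n) (by positivity)
  rw [← mul_sub, norm_mul, Real.norm_of_nonneg hw, Real.norm_eq_abs]
  rcases eq_or_ne n 0 with rfl | hn
  · simp [h.zero]
  · exact mul_le_mul_of_nonneg_left (hle _ (natCast_rpow_neg_mem_Icc hn hδ)) hw

lemma averaging_add (h : HasDirichletResidue A C) {f g : ℝ → ℝ}
    (hf : KaramataAveraging A C f) (hg : KaramataAveraging A C g) :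
    KaramataAveraging A C fun t => f t + g t where
  bounded := by
    obtain ⟨M, hM⟩ := hf.bounded
    obtain ⟨N, hN⟩ := hg.bounded
    exact ⟨M + N, fun t ht => (abs_add_le _ _).trans (add_le_add (hM t ht) (hN t ht))⟩
  integrable := hf.integrable.add hg.integrable
  tendsto := by
    rw [intervalIntegral.integral_add hf.integrable hg.integrable, mul_add]
    refine (hf.tendsto.add hg.tendsto).congr' ?_
    filter_upwards [self_mem_nhdsWithin] with δ hδ
    exact (h.karamataMean_add hf.bounded hg.bounded hδ).symm

lemma averaging_const_mul {g : ℝ → ℝ} (hg : KaramataAveraging A C g) (r : ℝ) :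
    KaramataAveraging A C fun t => r * g t where
  bounded := by
    obtain ⟨M, hM⟩ := hg.bounded
    refine ⟨|r| * M, fun t ht => ?_⟩
    rw [abs_mul]
    exact mul_le_mul_of_nonneg_left (hM t ht) (abs_nonneg r)
  integrable := hg.integrable.const_mul r
  tendsto := by
    rw [intervalIntegral.integral_const_mul, mul_left_comm]
    exact (hg.tendsto.const_mul r).congr fun δ => (karamataMean_const_mul r g δ).symm

lemma averaging_pow (h : HasDirichletResidue A C) (j : ℕ) :
    KaramataAveraging A C fun t => t ^ j where
  bounded := ⟨1, fun t ht => by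
    rw [abs_of_nonneg (pow_nonneg ht.1 j)]
    exact pow_le_one₀ ht.1 ht.2⟩
  integrable := (continuous_pow j).intervalIntegrable 0 1
  tendsto := by
    have hj : (0 : ℝ) < j + 1 := by positivity
    have hscale : Tendsto (fun δ : ℝ => (j + 1) * δ) (𝓝[>] 0) (𝓝[>] 0) := by
      refine tendsto_nhdsWithin_iff.mpr ⟨?_, ?_⟩
      · have : Tendsto (fun δ : ℝ => (j + 1) * δ) (𝓝 0) (𝓝 ((j + 1) * 0)) :=
          tendsto_id.const_mul _
        rw [mul_zero] at this
        exact this.mono_left nhdsWithin_le_nhds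
      · filter_upwards [self_mem_nhdsWithin] with δ hδ
        exact mul_pos hj hδ
    have hlim := (h.tendsto.comp hscale).const_mul ((j : ℝ) + 1)⁻¹
    have hval : C * ∫ t in (0 : ℝ)..1, t ^ j = ((j : ℝ) + 1)⁻¹ * C := by
      rw [integral_pow]
      simp [div_eq_mul_inv, mul_comm]
    rw [hval]
    refine hlim.congr fun δ => ?_
    simp only [Function.comp_apply, karamataMean]
    rw [← mul_assoc, ← mul_assoc, inv_mul_cancel₀ hj.ne', one_mul]
    congr 1
    refine tsum_congr fun n => ?_
    rcases eq_or_ne n 0 with rfl | hn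
    · simp [h.zero]
    · have hn' : (0 : ℝ) < n := by positivity
      rw [mul_assoc, ← Real.rpow_natCast ((n : ℝ) ^ (-δ)), ← Real.rpow_mul hn'.le,
        ← Real.rpow_add hn']
      ring_nf

lemma averaging_polynomial (h : HasDirichletResidue A C) (p : Polynomial ℝ) :
    KaramataAveraging A C fun t => p.eval t := by
  induction p using Polynomial.induction_on' with
  | add p q hp hq => simpa only [Polynomial.eval_add] using h.averaging_add hp hq
  | monomial j r =>
    simpa only [Polynomial.eval_monomial] using averaging_const_mul (h.averaging_pow j) r

lemma averaging_of_approx (h : HasDirichletResidue A C) {g : ℝ → ℝ}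
    (hb : ∃ M, ∀ t ∈ Set.Icc (0 : ℝ) 1, |g t| ≤ M)
    (hi : IntervalIntegrable g volume 0 1)
    (happ : ∀ ε > 0, ∃ f e : ℝ → ℝ, KaramataAveraging A C f ∧ KaramataAveraging A C e ∧
      (∀ t ∈ Set.Icc (0 : ℝ) 1, |g t - f t| ≤ e t) ∧ ∫ t in (0 : ℝ)..1, e t ≤ ε) :
    KaramataAveraging A C g where
  bounded := hb
  integrable := hi
  tendsto := by
    rw [Metric.tendsto_nhds]
    intro ε hε
    have hC := h.residue_nonneg
    obtain ⟨f, e, hf, he, hle, hInt⟩ := happ (ε / (4 * (C + 1))) (by positivity)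
    have hCe : C * ∫ t in (0 : ℝ)..1, e t ≤ ε / 4 := by
      calc C * ∫ t in (0 : ℝ)..1, e t ≤ C * (ε / (4 * (C + 1))) := by gcongr
        _ = C / (C + 1) * (ε / 4) := by field_simp
        _ ≤ 1 * (ε / 4) := by
          gcongr
          exact (div_le_one (by positivity)).mpr (by linarith)
        _ = ε / 4 := one_mul _
    have hgf : |C * (∫ t in (0 : ℝ)..1, g t) - C * ∫ t in (0 : ℝ)..1, f t| ≤ ε / 4 := by
      rw [← mul_sub, ← intervalIntegral.integral_sub hi hf.integrable, abs_mul, abs_of_nonneg hC]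
      refine le_trans ?_ hCe
      gcongr
      refine (intervalIntegral.abs_integral_le_integral_abs zero_le_one).trans ?_
      exact intervalIntegral.integral_mono_on zero_le_one (hi.sub hf.integrable).abs
        he.integrable hle
    filter_upwards [self_mem_nhdsWithin,
      Metric.tendsto_nhds.mp hf.tendsto (ε / 4) (by positivity),
      Metric.tendsto_nhds.mp he.tendsto (ε / 4) (by positivity)] with δ hδ h1 h2
    have h3 := h.abs_karamataMean_sub_le hf.bounded hb he.bounded hle hδ
    rw [Real.dist_eq] at h1 h2 ⊢
    rw [abs_lt] at h1 h2 ⊢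
    rw [abs_le] at h3 hgf
    constructor <;> linarith

lemma averaging_of_continuous (h : HasDirichletResidue A C) {g : ℝ → ℝ} (hg : Continuous g) :
    KaramataAveraging A C g := by
  refine h.averaging_of_approx ?_ (hg.intervalIntegrable 0 1) fun ε hε => ?_
  · simpa using isCompact_Icc.exists_bound_of_continuousOn hg.continuousOn
  · obtain ⟨p, hp⟩ := exists_polynomial_near_of_continuousOn 0 1 g hg.continuousOn ε hε
    refine ⟨fun t => p.eval t, fun _ => ε, h.averaging_polynomial p, ?_, fun t ht => ?_, by simp⟩
    · simpa using h.averaging_polynomial (Polynomial.C ε)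
    · rw [abs_sub_comm]
      exact (hp t ht).le

lemma averaging_indicator_Ici (h : HasDirichletResidue A C) {w : ℝ → ℝ} (hw : Continuous w)
    (b : ℝ) :
    KaramataAveraging A C ((Set.Ici b).indicator w) := by
  obtain ⟨M, hM⟩ : ∃ M, ∀ t ∈ Set.Icc (0 : ℝ) 1, |w t| ≤ M := by
    simpa using isCompact_Icc.exists_bound_of_continuousOn hw.continuousOn
  have hM0 : 0 ≤ M := (abs_nonneg _).trans (hM 0 (by simp))
  have hMi : ∀ t ∈ Set.Icc (0 : ℝ) 1, |(Set.Ici b).indicator w t| ≤ M := by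
    intro t ht
    by_cases hbt : t ∈ Set.Ici b
    · simpa [hbt] using hM t ht
    · simpa [hbt] using hM0
  refine h.averaging_of_approx ⟨M, hMi⟩ ?_ fun ε hε => ?_
  · rw [intervalIntegrable_iff]
    exact ((intervalIntegrable_iff.mp (hw.intervalIntegrable 0 1))).indicator measurableSet_Ici
  · set η : ℝ := ε / (2 * (M + 1)) with hη
    have hη0 : 0 < η := by positivity
    refine ⟨fun t => w t * max 0 (min 1 ((t - b) / η)), fun t => M * max 0 (1 - |t - b| / η),
      h.averaging_of_continuous (by fun_prop), h.averaging_of_continuous (by fun_prop),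
      fun t ht => ?_, ?_⟩
    · beta_reduce
      by_cases hbt : b ≤ t
      · have h0 : 0 ≤ (t - b) / η := div_nonneg (by linarith) hη0.le
        rw [Set.indicator_of_mem (show t ∈ Set.Ici b from hbt), ← mul_one_sub, abs_mul,
          abs_of_nonneg (sub_nonneg.mpr hbt)]
        refine mul_le_mul (hM t ht) ?_ (abs_nonneg _) hM0
        rw [max_eq_right (le_min zero_le_one h0), abs_le]
        rcases le_total 1 ((t - b) / η) with h1 | h1
        · rw [min_eq_left h1]; simp
        · rw [min_eq_right h1, max_eq_right (by linarith)]
          constructor <;> linarith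
      · have h0 : (t - b) / η ≤ 0 := div_nonpos_of_nonpos_of_nonneg (by linarith) hη0.le
        rw [Set.indicator_of_notMem (show t ∉ Set.Ici b from hbt),
          max_eq_left ((min_le_right _ _).trans h0)]
        simp only [mul_zero, sub_zero, abs_zero]
        exact mul_nonneg hM0 (le_max_left _ _)
    · have hbound : ∀ t, max 0 (1 - |t - b| / η) ≤
          (Set.Icc (b - η) (b + η)).indicator (fun _ => (1 : ℝ)) t := by
        intro t
        by_cases ht : t ∈ Set.Icc (b - η) (b + η)
        · rw [Set.indicator_of_mem ht]
          exact max_le zero_le_one (by have := div_nonneg (abs_nonneg (t - b)) hη0.le; linarith)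
        · rw [Set.indicator_of_notMem ht]
          refine max_le le_rfl (sub_nonpos.mpr ((one_le_div hη0).mpr ?_))
          by_contra! hlt
          rw [abs_lt] at hlt
          exact ht ⟨by linarith, by linarith⟩
      have hhat : ∫ t in (0 : ℝ)..1, max 0 (1 - |t - b| / η) ≤ 2 * η := by
        have hInt : Integrable ((Set.Icc (b - η) (b + η)).indicator fun _ => (1 : ℝ)) := by
          rw [integrable_indicator_iff measurableSet_Icc]
          exact integrableOn_const (by simp)
        rw [intervalIntegral.integral_of_le zero_le_one]
        calc ∫ t in Set.Ioc (0 : ℝ) 1, max 0 (1 - |t - b| / η)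
            ≤ ∫ t in Set.Ioc (0 : ℝ) 1, (Set.Icc (b - η) (b + η)).indicator (fun _ => (1 : ℝ)) t :=
              integral_mono ((show Continuous fun t => max 0 (1 - |t - b| / η) by
                fun_prop).integrableOn_Ioc) hInt.integrableOn hbound
          _ ≤ ∫ t, (Set.Icc (b - η) (b + η)).indicator (fun _ => (1 : ℝ)) t :=
              setIntegral_le_integral hInt
                (Eventually.of_forall fun t => Set.indicator_nonneg (fun _ _ => zero_le_one) t)
          _ = 2 * η := by
              rw [integral_indicator measurableSet_Icc]
              simp only [integral_const, MeasurableSet.univ, measureReal_restrict_apply,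
                Set.univ_inter, Real.volume_real_Icc, smul_eq_mul, mul_one]
              rw [max_eq_left (by linarith)]
              ring
      rw [intervalIntegral.integral_const_mul]
      calc M * ∫ t in (0 : ℝ)..1, max 0 (1 - |t - b| / η) ≤ M * (2 * η) := by gcongr
        _ ≤ (M + 1) * (2 * η) := by gcongr; linarith
        _ = ε := by rw [hη]; field_simp

end HasDirichletResidue

/-- A continuous function equal to `1 / (t * (-log t))` on `[exp (-c), exp (-1)]`. -/
noncomputable def logWeight (c t : ℝ) : ℝ :=
  (max t (rexp (-c)) * max (-Real.log (max t (rexp (-c)))) 1)⁻¹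

lemma continuous_logWeight (c : ℝ) : Continuous (logWeight c) := by
  have hpos : ∀ t : ℝ, 0 < max t (rexp (-c)) := fun t => lt_max_of_lt_right (Real.exp_pos _)
  have hmax : Continuous fun t : ℝ => max t (rexp (-c)) := by fun_prop
  refine (hmax.mul (((hmax.log fun t => (hpos t).ne').neg).max continuous_const)).inv₀ fun t => ?_
  exact (mul_pos (hpos t) (lt_max_of_lt_right one_pos)).ne'

lemma logWeight_exp_neg {c u : ℝ} (h1 : 1 ≤ u) (huc : u ≤ c) :
    logWeight c (rexp (-u)) = rexp u / u := by
  rw [logWeight, max_eq_left (Real.exp_le_exp.mpr (by linarith)), Real.log_exp, neg_neg,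
    max_eq_left h1, mul_inv, Real.exp_neg, inv_inv, div_eq_mul_inv]

lemma integral_indicator_Ici {w : ℝ → ℝ} {a b d : ℝ} (hab : a < b) (hbd : b ≤ d) :
    ∫ t in a..d, (Set.Ici b).indicator w t = ∫ t in b..d, w t := by
  rw [intervalIntegral.integral_of_le (hab.le.trans hbd), intervalIntegral.integral_of_le hbd,
    setIntegral_indicator measurableSet_Ici, ← integral_Icc_eq_integral_Ioc]
  congr 2
  ext t
  simp only [Set.mem_inter_iff, Set.mem_Ioc, Set.mem_Ici, Set.mem_Icc]
  constructor
  · rintro ⟨⟨-, h1⟩, h2⟩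
    exact ⟨h2, h1⟩
  · rintro ⟨h2, h1⟩
    exact ⟨⟨by linarith, h1⟩, h2⟩

lemma integral_logWeight {c : ℝ} (hc : 1 < c) :
    ∫ t in rexp (-c)..rexp (-1), logWeight c t = Real.log c := by
  have hle : rexp (-c) ≤ rexp (-1) := Real.exp_le_exp.mpr (by linarith)
  have hderiv : ∀ t ∈ Set.uIcc (rexp (-c)) (rexp (-1)),
      HasDerivAt (fun t => -Real.log (-Real.log t)) (logWeight c t) t := by
    intro t ht
    rw [Set.uIcc_of_le hle] at ht
    have ht0 : 0 < t := (Real.exp_pos _).trans_le ht.1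
    have hlog1 : Real.log t ≤ -1 := (Real.log_le_iff_le_exp ht0).mpr ht.2
    have hlogc : -c ≤ Real.log t := (Real.le_log_iff_exp_le ht0).mpr ht.1
    have hw := logWeight_exp_neg (c := c) (u := -Real.log t) (by linarith) (by linarith)
    rw [neg_neg, Real.exp_log ht0] at hw
    rw [hw, Real.exp_neg, Real.exp_log ht0]
    have hd : HasDerivAt (fun t => -Real.log (-Real.log t)) (-(-t⁻¹ / -Real.log t)) t :=
      (((Real.hasDerivAt_log ht0.ne').neg).log (show -Real.log t ≠ 0 by linarith)).neg
    exact hd.congr_deriv (by rw [neg_div, neg_neg])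
  rw [intervalIntegral.integral_eq_sub_of_hasDerivAt hderiv
    ((continuous_logWeight c).intervalIntegrable _ _)]
  simp

namespace HasDirichletResidue

lemma tendsto_sum_Ioc_div_log {A : ℕ → ℝ} {C : ℝ} (h : HasDirichletResidue A C) {c : ℝ}
    (hc : 1 < c) :
    Tendsto (fun x : ℝ => ∑ n ∈ Finset.Ioc ⌊x⌋₊ ⌊x ^ c⌋₊, A n / Real.log n) atTop
      (𝓝 (C * Real.log c)) := by
  have hw := continuous_logWeight c
  have hgood := h.averaging_add (h.averaging_indicator_Ici hw (rexp (-c)))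
    (averaging_const_mul (h.averaging_indicator_Ici hw (rexp (-1))) (-1))
  have hInt : ∫ t in (0 : ℝ)..1, ((Set.Ici (rexp (-c))).indicator (logWeight c) t +
      -1 * (Set.Ici (rexp (-1))).indicator (logWeight c) t) = Real.log c := by
    rw [intervalIntegral.integral_add (h.averaging_indicator_Ici hw _).integrable
      ((h.averaging_indicator_Ici hw _).integrable.const_mul _),
      intervalIntegral.integral_const_mul,
      integral_indicator_Ici (Real.exp_pos _) (Real.exp_le_one_iff.mpr (by linarith)),
      integral_indicator_Ici (Real.exp_pos _) (Real.exp_le_one_iff.mpr (by linarith)),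
      ← integral_logWeight hc, ← intervalIntegral.integral_add_adjacent_intervals
        (hw.intervalIntegrable (rexp (-c)) (rexp (-1))) (hw.intervalIntegrable (rexp (-1)) 1)]
    ring
  have hlim := hgood.tendsto
  rw [hInt] at hlim
  refine (hlim.comp (tendsto_inv_atTop_nhdsGT_zero.comp Real.tendsto_log_atTop)).congr' ?_
  filter_upwards [eventually_gt_atTop 1] with x hx
  have hx0 : 0 < x := by linarith
  have hL : 0 < Real.log x := Real.log_pos hx
  have hpow : ∀ n : ℕ, n ≠ 0 →
      (n : ℝ) ^ (-(Real.log x)⁻¹) = rexp (-(Real.log n / Real.log x)) := by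
    intro n hn
    rw [Real.rpow_def_of_pos (by positivity)]
    ring_nf
  have hle : ∀ n : ℕ, n ≠ 0 → ∀ r : ℝ,
      (rexp (-r) ≤ rexp (-(Real.log n / Real.log x)) ↔ (n : ℝ) ≤ x ^ r) := by
    intro n hn r
    rw [Real.exp_le_exp, neg_le_neg_iff, div_le_iff₀ hL, ← Real.log_rpow hx0,
      Real.log_le_log_iff (by positivity) (by positivity)]
  have hmem : ∀ n : ℕ, n ∈ Finset.Ioc ⌊x⌋₊ ⌊x ^ c⌋₊ ↔ x < n ∧ (n : ℝ) ≤ x ^ c := by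
    intro n
    rw [Finset.mem_Ioc, Nat.floor_lt hx0.le, Nat.le_floor_iff (by positivity)]
  simp only [Function.comp_apply, karamataMean]
  rw [tsum_eq_sum (s := Finset.Ioc ⌊x⌋₊ ⌊x ^ c⌋₊), Finset.mul_sum]
  · refine Finset.sum_congr rfl fun n hn => ?_
    obtain ⟨hxn, hnc⟩ := (hmem n).mp hn
    have hn1 : (1 : ℝ) < n := hx.trans hxn
    have hn0 : n ≠ 0 := by rintro rfl; norm_num at hn1
    have hlogn : 0 < Real.log n := Real.log_pos hn1
    have hge : 1 ≤ Real.log n / Real.log x :=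
      (one_le_div hL).mpr (Real.log_le_log hx0 hxn.le)
    have hlec : Real.log n / Real.log x ≤ c := by
      have := (hle n hn0 c).mpr hnc
      rw [Real.exp_le_exp] at this
      linarith
    rw [hpow n hn0, Set.indicator_of_mem (show _ ∈ Set.Ici _ from (hle n hn0 c).mpr hnc),
      Set.indicator_of_notMem (show _ ∉ Set.Ici (rexp (-1)) from fun hmem1 => ?_),
      logWeight_exp_neg hge hlec, Real.exp_neg]
    · have := (Real.exp_pos (Real.log n / Real.log x)).ne'
      field_simp
      ring
    · have := (hle n hn0 1).mp hmem1
      rw [Real.rpow_one] at this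
      linarith
  · intro n hn
    rcases eq_or_ne n 0 with rfl | hn0
    · simp [h.zero]
    rw [hmem, not_and_or, not_lt, not_le] at hn
    rw [hpow n hn0]
    rcases hn with hnx | hnc
    · have hxc : x ≤ x ^ c := Real.self_le_rpow_of_one_le hx.le hc.le
      rw [Set.indicator_of_mem (show _ ∈ Set.Ici _ from (hle n hn0 c).mpr (hnx.trans hxc)),
        Set.indicator_of_mem (show _ ∈ Set.Ici _ from (hle n hn0 1).mpr (by simpa using hnx))]
      ring
    · have hxc : x ≤ x ^ c := Real.self_le_rpow_of_one_le hx.le hc.le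
      rw [Set.indicator_of_notMem
          (show _ ∉ Set.Ici _ from fun hm => absurd ((hle n hn0 c).mp hm) (not_le.mpr hnc)),
        Set.indicator_of_notMem (show _ ∉ Set.Ici _ from fun hm => absurd ((hle n hn0 1).mp hm)
          (by rw [Real.rpow_one]; exact not_le.mpr (hxc.trans_lt hnc)))]
      ring

end HasDirichletResidue

section ResidueClass

open ArithmeticFunction.vonMangoldt

lemma residueClass_div_mul_rpow_neg {q : ℕ} {a : ZMod q} (n : ℕ) {δ : ℝ} :
    residueClass a n / n * (n : ℝ) ^ (-δ) = residueClass a n / (n : ℝ) ^ (1 + δ) := by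
  rcases eq_or_ne n 0 with rfl | hn
  · simp
  · have hn' : (0 : ℝ) < n := by positivity
    rw [Real.rpow_add hn', Real.rpow_one, Real.rpow_neg hn'.le, ← div_eq_mul_inv, div_div]

variable {q : ℕ} [NeZero q] {a : ZMod q}

lemma tsum_residueClass_eq (ha : IsUnit a) {x : ℝ} (hx : 1 < x) :
    ∑' n, residueClass a n / (n : ℝ) ^ x =
      (LFunctionResidueClassAux a x).re + (q.totient : ℝ)⁻¹ / (x - 1) := by
  refine Complex.ofReal_injective ?_
  simp only [Complex.ofReal_tsum, Complex.ofReal_div, Complex.ofReal_cpow (Nat.cast_nonneg _),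
    Complex.ofReal_natCast, Complex.ofReal_add, Complex.ofReal_inv, Complex.ofReal_sub,
    Complex.ofReal_one]
  simp_rw [← LFunctionResidueClassAux_real ha hx,
    eqOn_LFunctionResidueClassAux ha <| Set.mem_ofPred.mpr (Complex.ofReal_re x ▸ hx),
    sub_add_cancel, LSeries, LSeries.term]
  refine tsum_congr fun n ↦ ?_
  split_ifs with hn
  · simp only [hn, residueClass_apply_zero, Complex.ofReal_zero, zero_div]
  · rfl

lemma hasDirichletResidue_residueClass (ha : IsUnit a) :
    HasDirichletResidue (fun n => residueClass a n / n) (q.totient : ℝ)⁻¹ where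
  nonneg n := div_nonneg (residueClass_nonneg a n) n.cast_nonneg
  zero := by simp
  residue_nonneg := by positivity
  summable δ hδ := by
    simp_rw [residueClass_div_mul_rpow_neg]
    exact LSeries.summable_real_of_abscissaOfAbsConv_lt <|
      (abscissaOfAbsConv_residueClass_le_one a).trans_lt <| by
        exact_mod_cast (by linarith : (1 : ℝ) < 1 + δ)
  tendsto := by
    have hcont : Tendsto (fun δ : ℝ => (LFunctionResidueClassAux a ((1 + δ : ℝ) : ℂ)).re)
        (𝓝[>] 0) (𝓝 (LFunctionResidueClassAux a 1).re) := by
      refine (Complex.continuous_re.tendsto _).comp ?_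
      refine ((continuousOn_LFunctionResidueClassAux a) 1 (by simp)).tendsto.comp ?_
      refine tendsto_nhdsWithin_iff.mpr ⟨?_, ?_⟩
      · have : Continuous fun δ : ℝ => ((1 + δ : ℝ) : ℂ) := by fun_prop
        simpa using (this.tendsto 0).mono_left nhdsWithin_le_nhds
      · filter_upwards [self_mem_nhdsWithin] with δ hδ
        have : (0 : ℝ) < δ := hδ
        simpa using this.le
    have hid : Tendsto (fun δ : ℝ => δ) (𝓝[>] 0) (𝓝 0) := nhdsWithin_le_nhds
    have hlim := (hid.mul hcont).add_const (q.totient : ℝ)⁻¹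
    rw [zero_mul, zero_add] at hlim
    refine hlim.congr' ?_
    filter_upwards [self_mem_nhdsWithin] with δ hδ
    have hδ0 : (0 : ℝ) < δ := hδ
    simp_rw [residueClass_div_mul_rpow_neg]
    rw [tsum_residueClass_eq ha (by linarith), add_sub_cancel_left, mul_add,
      mul_div_cancel₀ _ hδ0.ne']

end ResidueClass

section PrimeSums

variable {m n : ℕ}

lemma mem_primesTo {x : ℝ} (hx : 0 ≤ x) {p : ℕ} :
    p ∈ primesTo x m n ↔ (p : ℝ) ≤ x ∧ p.Prime ∧ p % m = n % m := by
  rw [primesTo, Finset.mem_filter, Finset.mem_range, Nat.lt_succ_iff, Nat.le_floor_iff hx]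

lemma piCount_eq_piPow_zero (x : ℝ) : piCount x m n = piPow 0 x m n := by
  simp [piCount, piPow]

lemma primesTo_mono {x y : ℝ} (hxy : x ≤ y) : primesTo x m n ⊆ primesTo y m n :=
  Finset.filter_subset_filter _
    (Finset.range_mono (Nat.add_le_add_right (Nat.floor_mono hxy) 1))

lemma piPow_sub_piPow {k x y : ℝ} (hxy : x ≤ y) :
    piPow k y m n - piPow k x m n =
      ∑ p ∈ Finset.Ioc ⌊x⌋₊ ⌊y⌋₊, if p.Prime ∧ p % m = n % m then (p : ℝ) ^ k else 0 := by
  rw [piPow, piPow, ← Finset.sum_sdiff (primesTo_mono hxy), add_sub_cancel_right,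
    ← Finset.sum_filter]
  refine Finset.sum_congr ?_ fun _ _ => rfl
  ext p
  simp only [primesTo, Finset.mem_sdiff, Finset.mem_filter, Finset.mem_range, Finset.mem_Ioc,
    Nat.lt_succ_iff]
  constructor
  · rintro ⟨⟨h1, h2⟩, h3⟩
    exact ⟨⟨not_le.mp fun h => h3 ⟨h, h2⟩, h1⟩, h2⟩
  · rintro ⟨⟨h1, h2⟩, h3⟩
    exact ⟨⟨h2, h3⟩, fun h => absurd h.1 (not_le.mpr h1)⟩

open ArithmeticFunction.vonMangoldt in
lemma reciprocal_prime_eq {p : ℕ} (hp : 1 < p) :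
    (if p.Prime ∧ p % m = n % m then (p : ℝ) ^ (-1 : ℝ) else 0) =
      residueClass (n : ZMod m) p / p / Real.log p -
        (if p.Prime then 0 else residueClass (n : ZMod m) p) / p / Real.log p := by
  have hlog : Real.log p ≠ 0 := (Real.log_pos (by exact_mod_cast hp)).ne'
  have hp0 : (p : ℝ) ≠ 0 := by positivity
  by_cases hprime : p.Prime
  · by_cases hmod : p % m = n % m
    · have hcast : (p : ZMod m) = n := (ZMod.natCast_eq_natCast_iff _ _ _).mpr hmod
      rw [if_pos ⟨hprime, hmod⟩, if_pos hprime, residueClass,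
        Set.indicator_of_mem (show p ∈ {k : ℕ | (k : ZMod m) = n} from hcast),
        ArithmeticFunction.vonMangoldt_apply_prime hprime, Real.rpow_neg_one]
      field_simp
      simp
    · have hcast : ¬(p : ZMod m) = n := fun h =>
        hmod ((ZMod.natCast_eq_natCast_iff _ _ _).mp h)
      rw [if_neg (fun h => hmod h.2), if_pos hprime, residueClass,
        Set.indicator_of_notMem (show p ∉ {k : ℕ | (k : ZMod m) = n} from hcast)]
      simp
  · rw [if_neg (fun h => hprime h.1), if_neg hprime, sub_self]

lemma tendsto_sum_Ioc_zero_of_summable {f : ℕ → ℝ} (hf : Summable f) {u v : ℝ → ℝ}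
    (hu : Tendsto u atTop atTop) (huv : ∀ᶠ x in atTop, u x ≤ v x) :
    Tendsto (fun x => ∑ n ∈ Finset.Ioc ⌊u x⌋₊ ⌊v x⌋₊, f n) atTop (𝓝 0) := by
  have hv : Tendsto v atTop atTop := tendsto_atTop_mono' _ huv hu
  have hpart : ∀ {w : ℝ → ℝ}, Tendsto w atTop atTop →
      Tendsto (fun x => ∑ n ∈ Finset.range (⌊w x⌋₊ + 1), f n) atTop (𝓝 (∑' n, f n)) :=
    fun hw => hf.hasSum.tendsto_sum_nat.comp
      ((tendsto_add_atTop_nat 1).comp (tendsto_nat_floor_atTop.comp hw))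
  have hlim := (hpart hv).sub (hpart hu)
  rw [sub_self] at hlim
  refine hlim.congr' ?_
  filter_upwards [huv] with x hx
  rw [← Finset.sum_Ico_eq_sub _ (Nat.add_le_add_right (Nat.floor_mono hx) 1)]
  refine Finset.sum_congr ?_ fun _ _ => rfl
  ext i
  simp only [Finset.mem_Ico, Finset.mem_Ioc]
  omega

open ArithmeticFunction.vonMangoldt in
lemma tendsto_reciprocal_sub_of_one_lt (hm : 0 < m) (hmn : Nat.Coprime m n) {c : ℝ}
    (hc : 1 < c) :
    Tendsto (fun x : ℝ => piPow (-1) (x ^ c) m n - piPow (-1) x m n) atTop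
      (𝓝 (Real.log c / m.totient)) := by
  have : NeZero m := ⟨hm.ne'⟩
  have ha : IsUnit (n : ZMod m) := (ZMod.isUnit_iff_coprime n m).mpr hmn.symm
  have hmain := (hasDirichletResidue_residueClass ha).tendsto_sum_Ioc_div_log hc
  have hle : ∀ᶠ x : ℝ in atTop, x ≤ x ^ c := by
    filter_upwards [eventually_ge_atTop 1] with x hx
    exact Real.self_le_rpow_of_one_le hx hc.le
  have hrem : Tendsto (fun x : ℝ => ∑ p ∈ Finset.Ioc ⌊x⌋₊ ⌊x ^ c⌋₊,
      (if p.Prime then 0 else residueClass (n : ZMod m) p) / p / Real.log p) atTop (𝓝 0) := by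
    have hnonneg : ∀ p : ℕ, 0 ≤ (if p.Prime then 0 else residueClass (n : ZMod m) p) / p := by
      intro p
      refine div_nonneg ?_ p.cast_nonneg
      split_ifs
      exacts [le_rfl, residueClass_nonneg _ p]
    refine squeeze_zero' (Eventually.of_forall fun x => Finset.sum_nonneg fun p _ =>
      div_nonneg (hnonneg p) (Real.log_natCast_nonneg p)) ?_
      (tendsto_sum_Ioc_zero_of_summable (summable_residueClass_non_primes_div (n : ZMod m))
        tendsto_id hle)
    filter_upwards [eventually_ge_atTop (rexp 1)] with x hx
    refine Finset.sum_le_sum fun p hp => div_le_self (hnonneg p) ?_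
    have hx0 : 0 < x := (Real.exp_pos 1).trans_le hx
    have hxp : x < p := (Nat.floor_lt hx0.le).mp (Finset.mem_Ioc.mp hp).1
    exact (Real.le_log_iff_exp_le (hx0.trans hxp)).mpr (hx.trans hxp.le)
  have hlim := hmain.sub hrem
  rw [sub_zero, inv_mul_eq_div] at hlim
  refine hlim.congr' ?_
  filter_upwards [hle, eventually_ge_atTop 1] with x hx hx1
  rw [piPow_sub_piPow hx, ← Finset.sum_sub_distrib]
  refine Finset.sum_congr rfl fun p hp => (reciprocal_prime_eq ?_).symm
  exact ((Nat.one_le_floor_iff x).mpr hx1).trans_lt (Finset.mem_Ioc.mp hp).1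

lemma tendsto_reciprocal_sub (hm : 0 < m) (hmn : Nat.Coprime m n) {c : ℝ} (hc : 0 < c) :
    Tendsto (fun x : ℝ => piPow (-1) (x ^ c) m n - piPow (-1) x m n) atTop
      (𝓝 (Real.log c / m.totient)) := by
  rcases lt_trichotomy c 1 with h | rfl | h
  · have hlim := ((tendsto_reciprocal_sub_of_one_lt hm hmn (one_lt_inv_iff₀.mpr ⟨hc, h⟩)).comp
      (tendsto_rpow_atTop hc)).neg
    rw [Real.log_inv, neg_div, neg_neg] at hlim
    refine hlim.congr' ?_
    filter_upwards [eventually_ge_atTop 0] with x hx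
    simp only [Function.comp_apply]
    rw [Real.rpow_rpow_inv hx hc.ne', neg_sub]
  · simp
  · exact tendsto_reciprocal_sub_of_one_lt hm hmn h

lemma sum_rpow_le {T : Finset ℕ} {k y : ℝ} (hk : 0 < k + 1)
    (hT : ∀ p ∈ T, 0 < p ∧ (p : ℝ) ≤ y) :
    ∑ p ∈ T, (p : ℝ) ^ k ≤ y ^ (k + 1) * ∑ p ∈ T, (p : ℝ) ^ (-1 : ℝ) := by
  rw [Finset.mul_sum]
  refine Finset.sum_le_sum fun p hp => ?_
  obtain ⟨hp0, hpy⟩ := hT p hp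
  have hp0' : (0 : ℝ) < p := by exact_mod_cast hp0
  calc (p : ℝ) ^ k = (p : ℝ) ^ (k + 1) * (p : ℝ) ^ (-1 : ℝ) := by
        rw [← Real.rpow_add hp0']
        ring_nf
    _ ≤ y ^ (k + 1) * (p : ℝ) ^ (-1 : ℝ) := by gcongr

lemma piPow_neg_one_le {x : ℝ} (hx : 1 ≤ x) : piPow (-1) x m n ≤ 1 + Real.log x := by
  have hfloor : 1 ≤ ⌊x⌋₊ := (Nat.one_le_floor_iff x).mpr hx
  calc piPow (-1) x m n ≤ ∑ p ∈ Finset.Icc 1 ⌊x⌋₊, (p : ℝ) ^ (-1 : ℝ) := by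
        refine Finset.sum_le_sum_of_subset_of_nonneg (fun p hp => ?_) fun p _ _ => by positivity
        rw [primesTo, Finset.mem_filter, Finset.mem_range] at hp
        exact Finset.mem_Icc.mpr ⟨hp.2.1.one_le, Nat.lt_succ_iff.mp hp.1⟩
    _ = (harmonic ⌊x⌋₊ : ℝ) := by
        rw [harmonic_eq_sum_Icc]
        push_cast
        exact Finset.sum_congr rfl fun p _ => Real.rpow_neg_one _
    _ ≤ 1 + Real.log ⌊x⌋₊ := harmonic_le_one_add_log _
    _ ≤ 1 + Real.log x := by
        gcongr
        exact Nat.floor_le (by linarith)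

lemma piPow_div_rpow_le {k c x : ℝ} (hk : 0 < k + 1) (hc0 : 0 ≤ c) (hc1 : c ≤ 1) (hx : 1 ≤ x) :
    piPow k x m n / x ^ (k + 1) ≤ (piPow (-1) x m n - piPow (-1) (x ^ c) m n) +
      x ^ (-((1 - c) * (k + 1))) * (1 + Real.log x) := by
  have hx0 : 0 < x := by linarith
  have hcx : x ^ c ≤ x := Real.rpow_le_self_of_one_le hx hc1
  have hxc1 : 1 ≤ x ^ c := Real.one_le_rpow hx hc0
  have hsub : primesTo (x ^ c) m n ⊆ primesTo x m n := primesTo_mono hcx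
  have hdiff := Finset.sum_sdiff (f := fun p : ℕ => (p : ℝ) ^ (-1 : ℝ)) hsub
  have hlarge : ∑ p ∈ primesTo x m n \ primesTo (x ^ c) m n, (p : ℝ) ^ k ≤
      x ^ (k + 1) * (piPow (-1) x m n - piPow (-1) (x ^ c) m n) := by
    refine (sum_rpow_le (y := x) hk fun p hp => ?_).trans_eq ?_
    · have hp' := (mem_primesTo hx0.le).mp (Finset.mem_sdiff.mp hp).1
      exact ⟨hp'.2.1.pos, hp'.1⟩
    · rw [piPow, piPow, ← hdiff, add_sub_cancel_right]
  have hsmall : piPow k (x ^ c) m n ≤ (x ^ c) ^ (k + 1) * (1 + Real.log x) := by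
    refine (sum_rpow_le (y := x ^ c) hk fun p hp => ?_).trans ?_
    · have hp' := (mem_primesTo (by positivity)).mp hp
      exact ⟨hp'.2.1.pos, hp'.1⟩
    · refine mul_le_mul_of_nonneg_left ?_ (by positivity)
      refine (piPow_neg_one_le hxc1).trans ?_
      gcongr
  have hexp : (x ^ c) ^ (k + 1) = x ^ (k + 1) * x ^ (-((1 - c) * (k + 1))) := by
    rw [← Real.rpow_mul hx0.le, ← Real.rpow_add hx0]
    ring_nf
  rw [div_le_iff₀ (by positivity)]
  calc piPow k x m n = ∑ p ∈ primesTo x m n \ primesTo (x ^ c) m n, (p : ℝ) ^ k +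
        piPow k (x ^ c) m n := (Finset.sum_sdiff hsub).symm
    _ ≤ _ := add_le_add hlarge hsmall
    _ = _ := by
      rw [hexp]
      ring

lemma tendsto_rpow_neg_mul_one_add_log {r : ℝ} (hr : 0 < r) :
    Tendsto (fun x : ℝ => x ^ (-r) * (1 + Real.log x)) atTop (𝓝 0) := by
  have h1 := tendsto_rpow_neg_atTop hr
  have h2 := (isLittleO_log_rpow_atTop hr).tendsto_div_nhds_zero
  have h3 := h1.add h2
  rw [add_zero] at h3
  refine h3.congr' ?_
  filter_upwards [eventually_ge_atTop 0] with x hx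
  rw [Real.rpow_neg hx]
  ring

lemma tendsto_piPow_div_rpow (hm : 0 < m) (hmn : Nat.Coprime m n) {k : ℝ} (hk : 0 < k + 1) :
    Tendsto (fun x : ℝ => piPow k x m n / x ^ (k + 1)) atTop (𝓝 0) := by
  have hφ : (0 : ℝ) < m.totient := by exact_mod_cast Nat.totient_pos.mpr hm
  refine tendsto_order.mpr ⟨fun ε hε => ?_, fun ε hε => ?_⟩
  · filter_upwards [eventually_ge_atTop 0] with x hx
    exact hε.trans_le (div_nonneg (Finset.sum_nonneg fun p _ => by positivity) (by positivity))
  · set c : ℝ := rexp (-(ε * m.totient / 2)) with hc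
    have hc0 : 0 < c := Real.exp_pos _
    have hc1 : c < 1 := Real.exp_lt_one_iff.mpr (neg_lt_zero.mpr (by positivity))
    have hlog : -(Real.log c / m.totient) + 0 < ε := by
      rw [hc, Real.log_exp, neg_div, neg_neg, add_zero, div_div, mul_div_mul_right _ _ hφ.ne']
      linarith
    have hlim := ((tendsto_reciprocal_sub hm hmn hc0).neg).add
      (tendsto_rpow_neg_mul_one_add_log (mul_pos (sub_pos.mpr hc1) hk))
    filter_upwards [hlim.eventually_lt_const hlog, eventually_ge_atTop 1] with x hx hx1
    rw [neg_sub] at hx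
    exact (piPow_div_rpow_le hk hc0.le hc1.le hx1).trans_lt hx

lemma integral_step_div_rpow {c x q : ℝ} (hc : 0 < c) (hq : 1 < q) (hqx : q ≤ x) (r : ℝ) :
    ∫ t in (1 : ℝ)..x, (Set.Ici q).indicator (fun t => r / t ^ (c + 1)) t =
      r * (q ^ (-c) - x ^ (-c)) / c := by
  have hmem : (0 : ℝ) ∉ Set.uIcc q x := by
    rw [Set.uIcc_of_le hqx]
    exact fun h => by linarith [h.1]
  rw [integral_indicator_Ici hq hqx]
  have hcongr : ∫ t in q..x, r / t ^ (c + 1) = ∫ t in q..x, r * t ^ (-(c + 1)) := by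
    refine intervalIntegral.integral_congr fun t ht => ?_
    rw [Set.uIcc_of_le hqx] at ht
    simp only [Real.rpow_neg (by linarith [ht.1] : (0 : ℝ) ≤ t), div_eq_mul_inv]
  rw [hcongr, intervalIntegral.integral_const_mul,
    integral_rpow (Or.inr ⟨by linarith, hmem⟩), show -(c + 1) + 1 = -c by ring]
  field_simp
  ring

lemma intervalIntegrable_step_div_rpow {c x : ℝ} (hx : 1 ≤ x) (q r : ℝ) :
    IntervalIntegrable ((Set.Ici q).indicator fun t => r / t ^ (c + 1)) volume 1 x := by
  have hcont : ContinuousOn (fun t : ℝ => r / t ^ (c + 1)) (Set.uIcc 1 x) := by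
    rw [Set.uIcc_of_le hx]
    intro t ht
    have ht0 : 0 < t := by linarith [ht.1]
    exact (continuousAt_const.div (Real.continuousAt_rpow_const _ _ (Or.inl ht0.ne'))
      (Real.rpow_pos_of_pos ht0 _).ne').continuousWithinAt
  rw [intervalIntegrable_iff]
  exact (intervalIntegrable_iff.mp hcont.intervalIntegrable).indicator measurableSet_Ici

lemma piPow_div_eq_sum {k c t x : ℝ} (ht : t ∈ Set.uIcc 1 x) (hx : 1 ≤ x) :
    piPow k t m n / t ^ (c + 1) =
      ∑ p ∈ primesTo x m n, (Set.Ici (p : ℝ)).indicator (fun t => (p : ℝ) ^ k / t ^ (c + 1)) t := by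
  rw [Set.uIcc_of_le hx] at ht
  have hfilter : primesTo t m n = (primesTo x m n).filter fun p : ℕ => (p : ℝ) ≤ t := by
    ext p
    rw [Finset.mem_filter, mem_primesTo (by linarith [ht.1]), mem_primesTo (by linarith)]
    exact ⟨fun h => ⟨⟨h.1.trans ht.2, h.2⟩, h.1⟩, fun h => ⟨h.2, h.1.2⟩⟩
  rw [piPow, hfilter, Finset.sum_div, Finset.sum_filter]
  exact Finset.sum_congr rfl fun p _ => by simp [Set.indicator_apply]

lemma piCount_rpow_div_eq_sum {c t x : ℝ} (hc : 0 < c) (ht : t ∈ Set.uIcc 1 x) (hx : 1 ≤ x) :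
    piCount (t ^ c) m n / t ^ (c + 1) = ∑ p ∈ primesTo (x ^ c) m n,
      (Set.Ici ((p : ℝ) ^ c⁻¹)).indicator (fun t => 1 / t ^ (c + 1)) t := by
  rw [Set.uIcc_of_le hx] at ht
  have ht0 : 0 ≤ t := by linarith [ht.1]
  have hfilter : primesTo (t ^ c) m n =
      (primesTo (x ^ c) m n).filter fun p : ℕ => (p : ℝ) ^ c⁻¹ ≤ t := by
    ext p
    rw [Finset.mem_filter, mem_primesTo (by positivity), mem_primesTo (by positivity),
      Real.rpow_inv_le_iff_of_pos p.cast_nonneg ht0 hc]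
    exact ⟨fun h => ⟨⟨h.1.trans (Real.rpow_le_rpow ht0 ht.2 hc.le), h.2⟩, h.1⟩,
      fun h => ⟨h.2, h.1.2⟩⟩
  rw [piCount, hfilter, Finset.card_eq_sum_ones, Nat.cast_sum, Finset.sum_div, Finset.sum_filter]
  exact Finset.sum_congr rfl fun p _ => by simp [Set.indicator_apply]

lemma intervalIntegrable_piPow_div {k c x : ℝ} (hx : 1 ≤ x) :
    IntervalIntegrable (fun t => piPow k t m n / t ^ (c + 1)) volume 1 x := by
  refine IntervalIntegrable.congr ?_ (IntervalIntegrable.sum (primesTo x m n)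
    fun p _ => intervalIntegrable_step_div_rpow (c := c) hx p ((p : ℝ) ^ k))
  intro t ht
  simpa using (piPow_div_eq_sum (Set.uIoc_subset_uIcc ht) hx).symm

lemma intervalIntegrable_piCount_rpow_div {c x : ℝ} (hc : 0 < c) (hx : 1 ≤ x) :
    IntervalIntegrable (fun t => piCount (t ^ c) m n / t ^ (c + 1)) volume 1 x := by
  refine IntervalIntegrable.congr ?_ (IntervalIntegrable.sum (primesTo (x ^ c) m n)
    fun p _ => intervalIntegrable_step_div_rpow (c := c) hx ((p : ℝ) ^ c⁻¹) 1)
  intro t ht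
  simpa using (piCount_rpow_div_eq_sum hc (Set.uIoc_subset_uIcc ht) hx).symm

lemma integral_piPow_div {k x : ℝ} (hk : 0 < k + 1) (hx : 1 ≤ x) :
    ∫ t in (1 : ℝ)..x, piPow k t m n / t ^ (k + 1 + 1) =
      (piPow (-1) x m n - piPow k x m n / x ^ (k + 1)) / (k + 1) := by
  rw [intervalIntegral.integral_congr fun t ht => piPow_div_eq_sum ht hx,
    intervalIntegral.integral_finsetSum fun p _ => intervalIntegrable_step_div_rpow hx _ _,
    piPow, piPow, Finset.sum_div, ← Finset.sum_sub_distrib, Finset.sum_div]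
  refine Finset.sum_congr rfl fun p hp => ?_
  obtain ⟨hpx, hprime, -⟩ := (mem_primesTo (by linarith)).mp hp
  have hp0 : (0 : ℝ) < p := by exact_mod_cast hprime.pos
  rw [integral_step_div_rpow hk (by exact_mod_cast hprime.one_lt) hpx, mul_sub,
    ← Real.rpow_add hp0, show k + -(k + 1) = -1 by ring, Real.rpow_neg (by linarith : 0 ≤ x),
    div_eq_mul_inv ((p : ℝ) ^ k)]

lemma integral_piCount_rpow_div {c x : ℝ} (hc : 0 < c) (hx : 1 ≤ x) :
    ∫ t in (1 : ℝ)..x, piCount (t ^ c) m n / t ^ (c + 1) =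
      (piPow (-1) (x ^ c) m n - piCount (x ^ c) m n / x ^ c) / c := by
  rw [intervalIntegral.integral_congr fun t ht => piCount_rpow_div_eq_sum hc ht hx,
    intervalIntegral.integral_finsetSum fun p _ => intervalIntegrable_step_div_rpow hx _ _,
    piPow, piCount, Finset.card_eq_sum_ones, Nat.cast_sum, Finset.sum_div,
    ← Finset.sum_sub_distrib, Finset.sum_div]
  refine Finset.sum_congr rfl fun p hp => ?_
  obtain ⟨hpx, hprime, -⟩ := (mem_primesTo (by positivity)).mp hp
  have hx0 : 0 ≤ x := by linarith
  rw [integral_step_div_rpow hc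
      (Real.one_lt_rpow (by exact_mod_cast hprime.one_lt) (inv_pos.mpr hc))
      ((Real.rpow_inv_le_iff_of_pos p.cast_nonneg hx0 hc).mpr hpx),
    ← Real.rpow_mul p.cast_nonneg, show c⁻¹ * -c = -1 by field_simp, Real.rpow_neg hx0]
  simp

end PrimeSums

theorem stmt_3 (k : ℝ) (hk : k > -1) (m n : ℕ) (hm : 0 < m) (hn : 0 < n)
    (hmn : Nat.Coprime m n) :
    Tendsto (fun x : ℝ =>
        ∫ t in (1:ℝ)..x, (piPow k t m n - piCount (t ^ (k + 1)) m n) / t ^ (k + 2))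
      atTop (nhds (-Real.log (k + 1) / ((k + 1) * (Nat.totient m : ℝ)))) := by
  have hc : 0 < k + 1 := by linarith
  have hrec := tendsto_reciprocal_sub hm hmn hc
  have hpow := tendsto_piPow_div_rpow hm hmn hc
  have hcount := (tendsto_piPow_div_rpow (k := 0) hm hmn (by norm_num)).comp
    (tendsto_rpow_atTop hc)
  have hlim := ((hcount.sub hpow).sub hrec).div_const (k + 1)
  have hval : (0 - 0 - Real.log (k + 1) / m.totient) / (k + 1) =
      -Real.log (k + 1) / ((k + 1) * (m.totient : ℝ)) := by
    rw [sub_zero, zero_sub, ← neg_div, div_div, mul_comm (m.totient : ℝ)]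
  rw [hval] at hlim
  refine hlim.congr' ?_
  filter_upwards [eventually_ge_atTop 1] with x hx
  simp only [Function.comp_apply, zero_add, Real.rpow_one, sub_div]
  rw [show k + 2 = k + 1 + 1 by ring,
    intervalIntegral.integral_sub (intervalIntegrable_piPow_div hx)
      (intervalIntegrable_piCount_rpow_div hc hx),
    integral_piPow_div hc hx, integral_piCount_rpow_div hc hx, piCount_eq_piPow_zero]
  ring
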